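/- Let E be a real vector space, X a subset of E, and G : X → P(E) a KKM-mapping (i.e., for any finite set {x₁,…,xₙ} ⊂ X, the convex hull of {x₁,…,xₙ} is contained in ⋃ᵢ G(xᵢ)) such that each G(w) is finitely closed (its intersection with every finite-dimensional affine subspace L ⊂ E is closed in the Euclidean topology of L). Then the family {G(w)}_{w∈X} has the finite intersection property: every finite subfamily has nonempty intersection. -/

import Mathlib

/-- A subset `A` of a real vector space `E` is *finitely closed* if its preimage under every
affine map from a Euclidean space `ℝⁿ` into `E` is closed (i.e. the intersection of `A` with any
finite-dimensional affine subspace is closed in the Euclidean topology of that subspace). -/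
def FinitelyClosed {E : Type*} [AddCommGroup E] [Module ℝ E] (A : Set E) : Prop :=
  ∀ (n : ℕ) (L : (Fin n → ℝ) →ᵃ[ℝ] E), IsClosed (L ⁻¹' A)

namespace KKM
open Finset

variable {V I : Type} [Fintype V] [DecidableEq V] [Fintype I] [DecidableEq I]

def Dom (r : I → V → ℕ) (S : Finset V) : Prop := ∀ y, ∃ i, ∀ x ∈ S, r i y ≤ r i x

def PP (r : I → V → ℕ) (m : I → V) (l : I) (x : V) : Prop :=
  (∀ k, k ≠ l → r k (m k) < r k x) ∧
    ∀ y, (∀ k, k ≠ l → r k (m k) < r k y) → r l y ≤ r l x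

lemma room_of_PP (r : I → V → ℕ) (τ : Finset V) (hD : Dom r τ)
    (m : I → V) (hm : ∀ k, m k ∈ τ) (hmin : ∀ k, ∀ x ∈ τ, r k (m k) ≤ r k x)
    (hr : ∀ k, Function.Injective (r k))
    (l l' : I) (hl : l ≠ l') (hll : m l = m l') (x : V) (h : PP r m l x) :
    x ∉ τ ∧ Dom r (insert x τ) := by
  obtain ⟨h1, h2⟩ := h
  have key : ∀ y, (∀ k, k ≠ l → r k (m k) < r k y) → r l y ≤ r l (m l) := by
    intro y hy
    obtain ⟨k, hk⟩ := hD y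
    by_cases hkl : k = l
    · subst hkl; exact hk _ (hm _)
    · exact absurd (hk _ (hm k)) (not_le.2 (hy k hkl))
  refine ⟨fun hx => ?_, fun y => ?_⟩
  · have e : x = m l := hr l (le_antisymm (key x h1) (hmin l x hx))
    have := h1 l' hl.symm
    rw [e, hll] at this
    exact lt_irrefl _ this
  · by_cases hy : ∀ k, k ≠ l → r k (m k) < r k y
    · refine ⟨l, fun z hz => ?_⟩
      rcases Finset.mem_insert.1 hz with rfl | hz
      · exact h2 y hy
      · exact (key y hy).trans (hmin l z hz)
    · push Not at hy
      obtain ⟨k, hkl, hk⟩ := hy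
      refine ⟨k, fun z hz => ?_⟩
      rcases Finset.mem_insert.1 hz with rfl | hz
      · exact hk.trans (h1 k hkl).le
      · exact hk.trans (hmin k z hz)

lemma injOn_erase (τ : Finset V) (hc : τ.card + 1 = Fintype.card I) (m : I → V) (l : I)
    (hs : ∀ z ∈ τ, ∃ k, k ≠ l ∧ m k = z) :
    ∀ k k', k ≠ l → k' ≠ l → m k = m k' → k = k' := by
  have hsub : τ ⊆ (univ.erase l).image m := by
    intro z hz
    obtain ⟨k, hk, rfl⟩ := hs z hz
    exact mem_image_of_mem _ (by simp [hk])
  have h1 := card_le_card hsub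
  have h2 : (univ.erase l).card = τ.card := by
    rw [card_erase_of_mem (mem_univ _), card_univ, ← hc]; rfl
  have h3 : ((univ.erase l).image m).card = (univ.erase l).card :=
    le_antisymm card_image_le (h2 ▸ h1)
  have h4 := card_image_iff.1 h3
  intro k k' hk hk' he
  exact h4 (by simp [hk]) (by simp [hk']) he

lemma PP_of_room (r : I → V → ℕ) (τ : Finset V) (hc : τ.card + 1 = Fintype.card I)
    (m : I → V) (hm : ∀ k, m k ∈ τ) (hmin : ∀ k, ∀ x ∈ τ, r k (m k) ≤ r k x)
    (hr : ∀ k, Function.Injective (r k))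
    (i j : I) (hij : i ≠ j) (hmij : m i = m j) (x : V) (hx : x ∉ τ) (h : Dom r (insert x τ)) :
    PP r m i x ∨ PP r m j x := by
  obtain ⟨l, hl⟩ := h x
  have hs : ∀ z ∈ τ, ∃ k, k ≠ l ∧ m k = z ∧ r k z ≤ r k x := by
    intro z hz
    obtain ⟨k, hk⟩ := h z
    refine ⟨k, ?_, ?_, hk x (mem_insert_self _ _)⟩
    · rintro rfl
      have := hr k (le_antisymm (hk x (mem_insert_self _ _)) (hl z (mem_insert_of_mem hz)))
      exact hx (this ▸ hz)
    · exact hr k (le_antisymm (hmin k z hz) (hk _ (mem_insert_of_mem (hm k))))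
  have hinj := injOn_erase τ hc m l (fun z hz => by
    obtain ⟨k, h1, h2, _⟩ := hs z hz; exact ⟨k, h1, h2⟩)
  have hP : PP r m l x := by
    have h1 : ∀ k, k ≠ l → r k (m k) < r k x := by
      intro k hk
      obtain ⟨k', h1, h2, h3⟩ := hs (m k) (hm k)
      have : k' = k := hinj _ _ h1 hk h2
      subst this
      refine lt_of_le_of_ne h3 (fun e => hx ?_)
      rw [← hr _ e]; exact hm _
    refine ⟨h1, fun y hy => ?_⟩
    obtain ⟨k, hk⟩ := h y
    by_cases hkl : k = l
    · subst hkl; exact hk _ (mem_insert_self _ _)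
    · exact absurd (hk _ (mem_insert_of_mem (hm k))) (not_le.2 (hy k hkl))
  by_cases h1 : l = i
  · subst h1; exact Or.inl hP
  · by_cases h2 : l = j
    · subst h2; exact Or.inr hP
    · exact absurd (hinj i j (Ne.symm h1) (Ne.symm h2) hmij) hij

lemma exists_PP (r : I → V → ℕ) (m : I → V) (hr : ∀ k, Function.Injective (r k)) (l : I)
    (hne : ∃ y, ∀ k, k ≠ l → r k (m k) < r k y) :
    ∃ x, ∀ x', PP r m l x' ↔ x' = x := by
  classical
  obtain ⟨y, hy⟩ := hne
  obtain ⟨x, hx, hmax⟩ := Finset.exists_max_image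
    (univ.filter (fun y => ∀ k, k ≠ l → r k (m k) < r k y)) (r l) ⟨y, by simpa using hy⟩
  simp only [mem_filter, mem_univ, true_and] at hx hmax
  refine ⟨x, fun x' => ⟨fun h => ?_, ?_⟩⟩
  · exact hr l (le_antisymm (hmax x' h.1) (h.2 x hx))
  · rintro rfl; exact ⟨hx, hmax⟩

open Classical in
lemma door_even (r : I → V → ℕ) (τ : Finset V) (hc : τ.card + 1 = Fintype.card I)
    (hI : 2 ≤ Fintype.card I)
    (hr : ∀ k, Function.Injective (r k))
    (hne : ∀ (m : I → V), (∀ k, ∀ x ∈ τ, r k (m k) ≤ r k x) →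
      ∀ l, ∃ y, ∀ k, k ≠ l → r k (m k) < r k y) :
    Even (univ.filter (fun x => x ∉ τ ∧ Dom r (insert x τ))).card := by
  by_cases hD : Dom r τ
  swap
  · have : univ.filter (fun x => x ∉ τ ∧ Dom r (insert x τ)) = ∅ := by
      ext x
      simp only [mem_filter, mem_univ, true_and, notMem_empty, iff_false, not_and]
      intro _ h
      apply hD
      intro y
      obtain ⟨i, hi⟩ := h y
      exact ⟨i, fun z hz => hi z (mem_insert_of_mem hz)⟩
    rw [this]; simp
  have hτ : τ.Nonempty := by
    rw [← card_pos]; omega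
  choose m hm hmin using fun k => Finset.exists_min_image τ (r k) hτ
  obtain ⟨i, -, j, -, hij, hmij⟩ := Finset.exists_ne_map_eq_of_card_lt_of_maps_to
    (s := univ) (t := τ) (f := m) (by rw [card_univ]; omega) (fun k _ => hm k)
  obtain ⟨a, ha⟩ := exists_PP r m hr i (hne m hmin i)
  obtain ⟨b, hb⟩ := exists_PP r m hr j (hne m hmin j)
  have hab : a ≠ b := by
    rintro rfl
    have h1 := (ha a).2 rfl
    have h2 := (hb a).2 rfl
    obtain ⟨k, hk⟩ := hD a
    have h3 := hk _ (hm k)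
    by_cases hki : k = i
    · exact absurd h3 (not_le.2 (h2.1 k (hki ▸ hij)))
    · exact absurd h3 (not_le.2 (h1.1 k hki))
  have : univ.filter (fun x => x ∉ τ ∧ Dom r (insert x τ)) = {a, b} := by
    ext x
    simp only [mem_filter, mem_univ, true_and, mem_insert, mem_singleton]
    rw [← ha, ← hb]
    constructor
    · rintro ⟨h1, h2⟩
      exact PP_of_room r τ hc m hm hmin hr i j hij hmij x h1 h2
    · rintro (h | h)
      · exact room_of_PP r τ hD m hm hmin hr i j hij hmij x h
      · exact room_of_PP r τ hD m hm hmin hr j i hij.symm hmij.symm x h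
  rw [this, card_pair hab]
  exact even_two

open Classical in
lemma outer_one (r : I → V → ℕ) (e : I → V) (hr : ∀ k, Function.Injective (r k))
    (he : Function.Injective e)
    (hmin : ∀ i v, r i (e i) ≤ r i v)
    (hmax : ∀ i j v, i ≠ j → v ∉ Set.range e → r i v < r i (e j))
    (hv : ∃ v, v ∉ Set.range e) (i0 : I) :
    (univ.filter (fun x => x ∉ (univ.erase i0).image e ∧
      Dom r (insert x ((univ.erase i0).image e)))).card = 1 := by
  obtain ⟨v, hv⟩ := hv
  obtain ⟨x, hx, hxm⟩ := Finset.exists_max_image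
    (univ.filter (fun y => y ∉ Set.range e)) (r i0) ⟨v, by simpa using hv⟩
  simp only [mem_filter, mem_univ, true_and] at hx hxm
  have hno : ∀ k y, y ∉ Set.range e → ¬ r k y ≤ r k (e k) := by
    intro k y hy h
    exact hy ⟨k, hr k (le_antisymm (hmin k y) h)⟩
  rw [card_eq_one]
  refine ⟨x, ?_⟩
  ext z
  simp only [mem_filter, mem_univ, true_and, mem_singleton]
  constructor
  · rintro ⟨h1, h2⟩
    have hk : ∀ y, y ∉ Set.range e → r i0 y ≤ r i0 z := by
      intro y hy
      obtain ⟨k, hk⟩ := h2 y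
      by_cases hk0 : k = i0
      · subst hk0; exact hk _ (mem_insert_self _ _)
      · exact absurd (hk (e k) (mem_insert_of_mem (mem_image_of_mem _ (by simp [hk0]))))
          (hno k y hy)
    have hz : z ∉ Set.range e := by
      rintro ⟨k, rfl⟩
      by_cases hk0 : k = i0
      · subst hk0; exact hno _ _ hv (hk v hv)
      · exact h1 (mem_image_of_mem _ (by simp [hk0]))
    exact hr i0 (le_antisymm (hxm z hz) (hk x hx))
  · rintro rfl
    refine ⟨fun h => ?_, fun y => ?_⟩
    · obtain ⟨k, -, hk⟩ := mem_image.1 h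
      exact hx ⟨k, hk⟩
    · by_cases hy : y ∈ Set.range e
      · obtain ⟨k, rfl⟩ := hy
        exact ⟨k, fun _ _ => hmin _ _⟩
      · refine ⟨i0, fun w hw => ?_⟩
        rcases mem_insert.1 hw with rfl | hw
        · exact hxm y hy
        · obtain ⟨k, hk, rfl⟩ := mem_image.1 hw
          exact (hmax i0 k y (by simpa using (mem_erase.1 hk).1.symm) hy).le

lemma room_even (f : V → I) (S : Finset V) (hc : S.card = Fintype.card I)
    (hS : S.image f ≠ univ) (i0 : I) :
    Even (S.filter (fun x => (S.erase x).image f = univ.erase i0)).card := by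
  by_cases hem : (S.filter (fun x => (S.erase x).image f = univ.erase i0)) = ∅
  · rw [hem]; simp
  obtain ⟨x, hx⟩ := nonempty_iff_ne_empty.2 hem
  obtain ⟨hxS, hx⟩ := mem_filter.1 hx
  have hinj : Set.InjOn f (S.erase x) := by
    rw [← card_image_iff, hx, card_erase_of_mem hxS, card_erase_of_mem (mem_univ _), hc, card_univ]
  have hfx : f x ≠ i0 := by
    intro h
    apply hS
    rw [← insert_erase hxS, image_insert, hx, h, insert_erase (mem_univ _)]
  have : f x ∈ (S.erase x).image f := by rw [hx]; simp [hfx]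
  obtain ⟨x', hx', hff⟩ := mem_image.1 this
  obtain ⟨hne, hx'S⟩ := mem_erase.1 hx'
  have : (S.filter (fun x => (S.erase x).image f = univ.erase i0)) = {x, x'} := by
    ext z
    simp only [mem_filter, mem_insert, mem_singleton]
    constructor
    · rintro ⟨hz, h⟩
      by_contra! hcon
      have hzi : f z ∈ (S.erase x).image f := mem_image_of_mem _ (mem_erase.2 ⟨hcon.1, hz⟩)
      rw [hx, ← h] at hzi
      obtain ⟨w, hw, hwz⟩ := mem_image.1 hzi
      obtain ⟨hwz', hwS⟩ := mem_erase.1 hw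
      have hzx : z ∈ S.erase x := mem_erase.2 ⟨hcon.1, hz⟩
      by_cases hwx : w = x
      · subst hwx
        exact hcon.2 (hinj hzx hx' (hwz.symm.trans hff.symm))
      · exact hwz' (hinj (mem_erase.2 ⟨hwx, hwS⟩) hzx hwz)
    · rintro (rfl | rfl)
      · exact ⟨hxS, hx⟩
      · refine ⟨hx'S, ?_⟩
        rw [← hx]
        ext c
        simp only [mem_image, mem_erase]
        constructor
        · rintro ⟨a, ⟨h1, h2⟩, rfl⟩
          by_cases hax : a = x
          · exact ⟨z, ⟨hne, hx'S⟩, hax ▸ hff⟩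
          · exact ⟨a, ⟨hax, h2⟩, rfl⟩
        · rintro ⟨a, ⟨h1, h2⟩, rfl⟩
          by_cases hax : a = z
          · exact ⟨x, ⟨hne.symm, hxS⟩, hax ▸ hff.symm⟩
          · exact ⟨a, ⟨hax, h2⟩, rfl⟩
  rw [this, card_pair hne.symm]
  exact even_two

theorem scarf (r : I → V → ℕ) (e : I → V) (f : V → I) (hI : 2 ≤ Fintype.card I)
    (hr : ∀ k, Function.Injective (r k))
    (hfe : ∀ i, f (e i) = i)
    (hmin : ∀ i v, r i (e i) ≤ r i v)
    (hmax : ∀ i j v, i ≠ j → v ∉ Set.range e → r i v < r i (e j))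
    (hv : ∃ v, v ∉ Set.range e) :
    ∃ S : Finset V, S.image f = univ ∧ Dom r S := by
  classical
  by_contra! hcon
  have : Nonempty I := Fintype.card_pos_iff.1 (by omega)
  obtain ⟨i0⟩ := this
  have he : Function.Injective e := fun a b h => by rw [← hfe a, h, hfe]
  set A : Finset (Σ _ : Finset V, V) :=
    (univ.filter (fun τ : Finset V => τ.card + 1 = Fintype.card I ∧ τ.image f = univ.erase i0)).sigma
      (fun τ => univ.filter (fun x => x ∉ τ ∧ Dom r (insert x τ))) with hA
  set B : Finset (Σ _ : Finset V, V) :=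
    (univ.filter (fun S : Finset V => S.card = Fintype.card I ∧ Dom r S)).sigma
      (fun S => S.filter (fun x => (S.erase x).image f = univ.erase i0)) with hB
  have hAB : A.card = B.card := by
    refine Finset.card_nbij' (fun p => ⟨insert p.2 p.1, p.2⟩) (fun p => ⟨p.1.erase p.2, p.2⟩)
      ?_ ?_ ?_ ?_
    · rintro ⟨τ, x⟩ h
      simp only [hA, hB, coe_sigma, Set.mem_sigma_iff, mem_coe, mem_filter, mem_univ, true_and] at h ⊢
      obtain ⟨⟨h1, h2⟩, h3, h4⟩ := h
      refine ⟨⟨by rw [card_insert_of_notMem h3, h1], h4⟩, mem_insert_self _ _, ?_⟩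
      rw [erase_insert h3, h2]
    · rintro ⟨S, x⟩ h
      simp only [hA, hB, coe_sigma, Set.mem_sigma_iff, mem_coe, mem_filter, mem_univ, true_and] at h ⊢
      obtain ⟨⟨h1, h2⟩, h3, h4⟩ := h
      refine ⟨⟨by rw [card_erase_add_one h3, h1], h4⟩, notMem_erase _ _, ?_⟩
      rwa [insert_erase h3]
    · rintro ⟨τ, x⟩ h
      simp only [hA, coe_sigma, Set.mem_sigma_iff, mem_coe, mem_filter, mem_univ, true_and] at h
      simp [erase_insert h.2.1]
    · rintro ⟨S, x⟩ h
      simp only [hB, coe_sigma, Set.mem_sigma_iff, mem_coe, mem_filter, mem_univ, true_and] at h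
      simp [insert_erase h.2.1]
  have hBe : Even B.card := by
    rw [hB, card_sigma]
    refine Finset.even_sum _ (fun S hS => ?_)
    simp only [mem_filter, mem_univ, true_and] at hS
    exact room_even f S hS.1 (fun h => hcon S h hS.2) i0
  have hAo : Odd A.card := by
    rw [hA, card_sigma]
    have hmem : (univ.erase i0).image e ∈ (univ.filter (fun τ : Finset V =>
        τ.card + 1 = Fintype.card I ∧ τ.image f = univ.erase i0)) := by
      simp only [mem_filter, mem_univ, true_and]
      refine ⟨?_, ?_⟩
      · rw [card_image_of_injective _ he, card_erase_add_one (mem_univ _), card_univ]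
      · rw [image_image]
        have : f ∘ e = id := funext hfe
        rw [this, image_id]
    rw [← Finset.add_sum_erase _ _ hmem, outer_one r e hr he hmin hmax hv i0]
    refine Even.one_add (Finset.even_sum _ (fun τ hτ => ?_))
    simp only [mem_erase, mem_filter, mem_univ, true_and] at hτ
    obtain ⟨h1, h2, h3⟩ := hτ
    refine door_even r τ h2 hI hr ?_
    have : ∃ v ∈ τ, v ∉ Set.range e := by
      by_contra! hsub
      apply h1
      ext v
      constructor
      · intro hv
        obtain ⟨k, rfl⟩ := hsub v hv
        refine mem_image_of_mem _ ?_
        rw [← h3]; nth_rw 1 [← hfe k]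
        exact mem_image_of_mem _ hv
      · intro hv
        obtain ⟨k, hk, rfl⟩ := mem_image.1 hv
        rw [← h3] at hk
        obtain ⟨w, hw, rfl⟩ := mem_image.1 hk
        obtain ⟨k, rfl⟩ := hsub w hw
        rwa [hfe]
    obtain ⟨v, hvτ, hvr⟩ := this
    intro m hm l
    exact ⟨e l, fun k hk => (hm k v hvτ).trans_lt (hmax k l v hk hvr)⟩
  rw [hAB] at hAo
  exact (Nat.not_even_iff_odd.2 hAo) hBe


abbrev Grid (I : Type) [Fintype I] [DecidableEq I] (N : ℕ) : Type :=
  ↥(Finset.piAntidiag (univ : Finset I) N)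

lemma Grid.sum {N : ℕ} (x : Grid I N) : ∑ i, x.1 i = N := (mem_piAntidiag.1 x.2).1

lemma grid_lemma (hI : 2 ≤ Fintype.card I) (N : ℕ) (f : Grid I N → I) :
    ∃ (C : Finset I) (x0 : Grid I N),
      (∀ i ∈ C, ∃ x : Grid I N, f x = i ∧ ∀ k, x.1 k ≤ x0.1 k + Fintype.card I ∧
        x0.1 k ≤ x.1 k + Fintype.card I) ∧ ∀ i ∉ C, x0.1 i ≤ Fintype.card I := by
  classical
  set K := Fintype.card (Grid I N) with hK
  let en : Grid I N ≃ Fin K := Fintype.equivFin _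
  let enI : I ≃ Fin (Fintype.card I) := Fintype.equivFin _
  let r : I → Grid I N ⊕ I → ℕ := fun i v => Sum.elim
    (fun x => x.1 i * K + (en x : ℕ) + 1)
    (fun j => if j = i then 0 else (N + 1) * K + 1 + (enI j : ℕ)) v
  have hle : ∀ (x : Grid I N) i, x.1 i ≤ N := fun x i => by
    conv_rhs => rw [← x.sum]
    exact single_le_sum (f := x.1) (fun _ _ => Nat.zero_le _) (mem_univ i)
  have hlt : ∀ (x : Grid I N) i, x.1 i * K + (en x : ℕ) < (N + 1) * K := fun x i => by
    have h1 := (en x).2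
    have h2 := Nat.mul_le_mul_right K (hle x i)
    rw [Nat.add_mul, one_mul]; omega
  have hmono : ∀ (x y : Grid I N) i, x.1 i * K + (en x : ℕ) ≤ y.1 i * K + (en y : ℕ) →
      x.1 i ≤ y.1 i := fun x y i h => by
    by_contra! hc
    have h1 := (en y).2
    have h2 := Nat.mul_le_mul_right K (Nat.succ_le_of_lt hc)
    rw [Nat.succ_mul] at h2
    omega
  obtain ⟨c0⟩ : Nonempty I := Fintype.card_pos_iff.1 (by omega)
  have hT : Nonempty (Grid I N) := ⟨⟨Pi.single c0 N, by simp [mem_piAntidiag]⟩⟩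
  obtain ⟨S, hS, hD⟩ := scarf r Sum.inr (Sum.elim f id) hI
    (by
      intro k v w h
      rcases v with x | i <;> rcases w with y | j <;> simp only [r, Sum.elim_inl, Sum.elim_inr] at h
      · have h' : x.1 k * K + (en x : ℕ) = y.1 k * K + (en y : ℕ) := by omega
        have e1 := le_antisymm (hmono x y k h'.le) (hmono y x k h'.ge)
        rw [e1] at h'
        have : en x = en y := Fin.ext (by omega)
        rw [en.injective this]
      · have := hlt x k
        split_ifs at h <;> omega
      · have := hlt y k
        split_ifs at h <;> omega
      · split_ifs at h with h1 h2 h2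
        · rw [h1, h2]
        · omega
        · omega
        · have : enI i = enI j := Fin.ext (by omega)
          rw [enI.injective this])
    (fun i => rfl)
    (fun i v => by simp [r])
    (by
      intro i j v hij hv
      rcases v with x | k
      · have := hlt x i
        simp only [r, Sum.elim_inl, Sum.elim_inr, if_neg hij.symm]
        omega
      · exact absurd ⟨k, rfl⟩ hv)
    ⟨Sum.inl hT.some, by simp⟩
  set C : Finset I := univ.filter (fun i => Sum.inr i ∉ S) with hC
  have hCx : ∀ i ∈ C, ∃ x : Grid I N, Sum.inl x ∈ S ∧ f x = i := by
    intro i hi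
    have : i ∈ S.image (Sum.elim f id) := by rw [hS]; simp
    obtain ⟨v, hv, hvi⟩ := mem_image.1 this
    rcases v with x | j
    · exact ⟨x, hv, hvi⟩
    · simp only [Sum.elim_inr, id] at hvi
      subst hvi
      simp [hC] at hi
      exact absurd hv hi
  have hdom : ∀ y : Grid I N, ∃ i ∈ C, ∀ x : Grid I N, Sum.inl x ∈ S → y.1 i ≤ x.1 i := by
    intro y
    obtain ⟨i, hi⟩ := hD (Sum.inl y)
    refine ⟨i, ?_, fun x hx => ?_⟩
    · simp only [hC, mem_filter, mem_univ, true_and]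
      intro h
      have := hi _ h
      simp [r] at this
    · have := hi _ hx
      simp only [r, Sum.elim_inl] at this
      exact hmono y x i (by omega)
  obtain ⟨c, hc, -⟩ := hdom hT.some
  obtain ⟨x0, hx0, -⟩ := hCx c hc
  have hmu : ∀ i, ∃ x : Grid I N, Sum.inl x ∈ S ∧ ∀ y : Grid I N, Sum.inl y ∈ S → x.1 i ≤ y.1 i := by
    intro i
    obtain ⟨x, hx, hm⟩ := exists_min_image (univ.filter (fun x : Grid I N => Sum.inl x ∈ S))
      (fun x => x.1 i) ⟨x0, by simpa using hx0⟩
    exact ⟨x, by simpa using hx, fun y hy => hm y (by simpa using hy)⟩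
  choose z hzS hz using hmu
  let μ : I → ℕ := fun i => (z i).1 i
  have hbig : N < ∑ i ∈ C, (μ i + 1) := by
    by_contra! hcon
    have hs : ∑ i, ((if i ∈ C then μ i + 1 else 0) +
        (if i = c then N - ∑ i ∈ C, (μ i + 1) else 0)) = N := by
      rw [sum_add_distrib, sum_ite_mem, univ_inter, sum_ite_eq' univ c, if_pos (mem_univ _)]
      omega
    obtain ⟨i, hi, h⟩ := hdom ⟨fun i => (if i ∈ C then μ i + 1 else 0) +
        (if i = c then N - ∑ i ∈ C, (μ i + 1) else 0), by
          rw [mem_piAntidiag]; exact ⟨hs, fun _ _ => mem_univ _⟩⟩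
    have := h (z i) (hzS i)
    simp only [if_pos hi] at this
    change _ ≤ μ i at this
    omega
  rw [sum_add_distrib, sum_const, smul_eq_mul, mul_one] at hbig
  have hCn : C.card ≤ Fintype.card I := card_le_univ C
  have hin : ∀ x : Grid I N, Sum.inl x ∈ S → ∀ k ∈ C, μ k ≤ x.1 k ∧ x.1 k ≤ μ k + Fintype.card I := by
    intro x hx k hk
    refine ⟨hz k x hx, ?_⟩
    have h1 : ∑ i ∈ C, x.1 i = ∑ i ∈ C, (x.1 i - μ i) + ∑ i ∈ C, μ i := by
      rw [← sum_add_distrib]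
      exact sum_congr rfl (fun i _ => (Nat.sub_add_cancel (hz i x hx)).symm)
    have h2 : ∑ i ∈ C, x.1 i ≤ N := by
      conv_rhs => rw [← x.sum]
      exact sum_le_sum_of_subset (subset_univ _)
    have h3 := single_le_sum (f := fun i => x.1 i - μ i) (fun _ _ => Nat.zero_le _) hk
    omega
  have hout : ∀ x : Grid I N, Sum.inl x ∈ S → ∀ k ∉ C, x.1 k ≤ Fintype.card I := by
    intro x hx k hk
    have h2 : ∑ i ∈ insert k C, x.1 i ≤ N := by
      conv_rhs => rw [← x.sum]
      exact sum_le_sum_of_subset (subset_univ _)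
    rw [sum_insert hk] at h2
    have h3 : ∑ i ∈ C, μ i ≤ ∑ i ∈ C, x.1 i := sum_le_sum (fun i _ => hz i x hx)
    omega
  refine ⟨C, x0, fun i hi => ?_, fun i hi => hout x0 hx0 i hi⟩
  obtain ⟨x, hx, hfx⟩ := hCx i hi
  refine ⟨x, hfx, fun k => ?_⟩
  by_cases hk : k ∈ C
  · have h1 := hin x hx k hk
    have h2 := hin x0 hx0 k hk
    omega
  · have h1 := hout x hx k hk
    have h2 := hout x0 hx0 k hk
    omega

lemma exists_approx (hI : 2 ≤ Fintype.card I) (d : I → (I → ℝ) → ℝ)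
    (hd : ∀ i, Continuous (d i)) (hd0 : ∀ i x, 0 ≤ d i x) (ε : ℝ) (hε : 0 < ε) :
    ∃ x ∈ stdSimplex ℝ I, ∀ i, -ε ≤ d i x - x i * ∑ j, d j x := by
  classical
  have hcomp := isCompact_stdSimplex ℝ I
  have hcont : Continuous (fun (x : I → ℝ) (i : I) => d i x - x i * ∑ j, d j x) := by
    fun_prop
  have huc := hcomp.uniformContinuousOn_of_continuous hcont.continuousOn
  obtain ⟨δ, hδ, huc⟩ := Metric.uniformContinuousOn_iff.1 huc ε hε
  obtain ⟨B, hB⟩ := hcomp.exists_bound_of_continuousOn (f := fun x => ∑ j, d j x)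
    (by fun_prop : Continuous (fun x => ∑ j, d j x)).continuousOn
  have hB' : ∀ x ∈ stdSimplex ℝ I, ∑ j, d j x ≤ max B 1 := fun x hx =>
    ((le_abs_self _).trans (hB x hx)).trans (le_max_left _ _)
  have hB1 : 0 < max B 1 := lt_max_of_lt_right one_pos
  set n : ℝ := (Fintype.card I : ℝ) with hn
  obtain ⟨N, hN⟩ := exists_nat_gt (max (n / δ) (n * max B 1 / ε))
  have hn0 : 0 < n := by rw [hn]; exact_mod_cast (by omega : 0 < Fintype.card I)
  have hN0 : (0 : ℝ) < N := lt_of_le_of_lt (le_max_of_le_left (by positivity)) hN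
  have hN1 : n / N < δ := by
    have := (le_max_left _ _).trans_lt hN
    rw [div_lt_iff₀ hδ] at this
    rw [div_lt_iff₀ hN0]; linarith
  have hN2 : n / N * max B 1 ≤ ε := by
    have := (le_max_right _ _).trans_lt hN
    rw [div_lt_iff₀ hε] at this
    rw [div_mul_eq_mul_div, div_le_iff₀ hN0]; linarith
  let q : Grid I N → I → ℝ := fun x i => (x.1 i : ℝ) / N
  have hq : ∀ x, q x ∈ stdSimplex ℝ I := by
    intro x
    refine ⟨fun i => by positivity, ?_⟩
    simp only [q]
    rw [← sum_div, ← Nat.cast_sum, x.sum, div_self hN0.ne']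
  have hlab : ∀ x : Grid I N, ∃ i, 0 ≤ d i (q x) - q x i * ∑ j, d j (q x) := by
    intro x
    by_contra! h
    have : Nonempty I := Fintype.card_pos_iff.1 (by omega)
    have h1 := sum_lt_sum_of_nonempty (s := (univ : Finset I)) univ_nonempty (fun i _ => h i)
    rw [sum_sub_distrib, ← sum_mul, (hq x).2] at h1
    simp at h1
  choose f hf using hlab
  obtain ⟨C, x0, h1, h2⟩ := grid_lemma hI N f
  refine ⟨q x0, hq x0, fun i => ?_⟩
  by_cases hi : i ∈ C
  · obtain ⟨x, rfl, hx⟩ := h1 i hi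
    have hdist : dist (q x) (q x0) < δ := by
      refine lt_of_le_of_lt ((dist_pi_le_iff (by positivity)).2 (fun k => ?_)) hN1
      simp only [q]
      rw [Real.dist_eq, ← sub_div, abs_div, abs_of_pos hN0]
      refine div_le_div_of_nonneg_right ?_ hN0.le
      obtain ⟨ha, hb⟩ := hx k
      have ha' : (x.1 k : ℝ) ≤ x0.1 k + n := by rw [hn]; exact_mod_cast ha
      have hb' : (x0.1 k : ℝ) ≤ x.1 k + n := by rw [hn]; exact_mod_cast hb
      rw [abs_le]; constructor <;> linarith
    have h3 := huc _ (hq x) _ (hq x0) hdist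
    have h4 := (dist_le_pi_dist _ _ (f x)).trans_lt h3
    rw [Real.dist_eq] at h4
    have h5 := (abs_lt.1 h4).2
    have h6 := hf x
    linarith
  · have h3 : q x0 i ≤ n / N := by
      refine div_le_div_of_nonneg_right ?_ hN0.le
      rw [hn]; exact_mod_cast h2 i hi
    have h4 : q x0 i * ∑ j, d j (q x0) ≤ n / N * max B 1 :=
      mul_le_mul h3 (hB' _ (hq x0)) (sum_nonneg fun j _ => hd0 j _) (by positivity)
    have := hd0 i (q x0)
    linarith

lemma exists_exact (hI : 2 ≤ Fintype.card I) (d : I → (I → ℝ) → ℝ)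
    (hd : ∀ i, Continuous (d i)) (hd0 : ∀ i x, 0 ≤ d i x) :
    ∃ x ∈ stdSimplex ℝ I, ∀ i, d i x = x i * ∑ j, d j x := by
  classical
  have hne : Nonempty I := Fintype.card_pos_iff.1 (by omega)
  have hcomp := isCompact_stdSimplex ℝ I
  have hg : Continuous (fun x : I → ℝ => (univ : Finset I).inf' univ_nonempty
      (fun i => d i x - x i * ∑ j, d j x)) := by
    refine Continuous.finset_inf'_apply _ (fun i _ => ?_)
    fun_prop
  obtain ⟨x, hx, hmax⟩ := hcomp.exists_isMaxOn
    (by obtain ⟨y, hy, _⟩ := exists_approx hI d hd hd0 1 one_pos; exact ⟨y, hy⟩) hg.continuousOn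
  have h0 : ∀ i, 0 ≤ d i x - x i * ∑ j, d j x := by
    intro i
    refine le_of_forall_pos_le_add (fun ε hε => ?_)
    obtain ⟨y, hy, hyε⟩ := exists_approx hI d hd hd0 ε hε
    have h1 := hmax hy
    simp only [Set.mem_ofPred_eq] at h1
    have h2 := (Finset.le_inf' (s := univ) univ_nonempty _ (fun i _ => hyε i)).trans h1
    have h3 := h2.trans (Finset.inf'_le _ (mem_univ i))
    linarith
  refine ⟨x, hx, fun i => ?_⟩
  have hs : ∑ i, (d i x - x i * ∑ j, d j x) = 0 := by
    rw [sum_sub_distrib, ← sum_mul, hx.2]; simp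
  have := (sum_eq_zero_iff_of_nonneg (fun i _ => h0 i)).1 hs i (mem_univ i)
  linarith

lemma kkm_simplex (hI : 2 ≤ Fintype.card I) (F : I → Set (I → ℝ)) (hF : ∀ i, IsClosed (F i))
    (h : ∀ x ∈ stdSimplex ℝ I, ∃ i, 0 < x i ∧ x ∈ F i) : ∃ x, ∀ i, x ∈ F i := by
  have hFne : ∀ i, (F i).Nonempty := by
    intro i
    obtain ⟨j, hj, hF⟩ := h (Pi.single i 1) (single_mem_stdSimplex ℝ i)
    by_cases hij : j = i
    · subst hij; exact ⟨_, hF⟩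
    · simp [hij] at hj
  obtain ⟨x, hx, hxd⟩ := exists_exact hI (fun i x => Metric.infDist x (F i))
    (fun i => Metric.continuous_infDist_pt _) (fun i x => Metric.infDist_nonneg)
  obtain ⟨i, hi, hiF⟩ := h x hx
  have h1 := hxd i
  skip
  rw [Metric.infDist_zero_of_mem hiF] at h1
  have h2 : ∑ j, Metric.infDist x (F j) = 0 := by
    rcases mul_eq_zero.1 h1.symm with h | h
    · exact absurd h hi.ne'
    · exact h
  refine ⟨x, fun j => ?_⟩
  rw [(hF j).mem_iff_infDist_zero (hFne j), hxd j, h2, mul_zero]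

end KKM

/-- The Knaster–Kuratowski–Mazurkiewicz principle: if `G : X → 𝒫(E)` is a KKM-mapping with
finitely closed values, then the family `{G w}_{w ∈ X}` has the finite intersection property. -/
theorem kkm_principle {E : Type*} [AddCommGroup E] [Module ℝ E]
    (X : Set E) (G : E → Set E)
    (hclosed : ∀ w ∈ X, FinitelyClosed (G w))
    (hKKM : ∀ s : Finset E, ↑s ⊆ X → convexHull ℝ (s : Set E) ⊆ ⋃ x ∈ s, G x) :
    ∀ s : Finset E, ↑s ⊆ X → s.Nonempty → (⋂ x ∈ s, G x).Nonempty := by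
  classical
  intro s hs hne
  by_cases hcard : s.card = 1
  · obtain ⟨a, rfl⟩ := Finset.card_eq_one.1 hcard
    have := hKKM {a} hs (subset_convexHull ℝ _ (by simp : a ∈ (({a} : Finset E) : Set E)))
    exact ⟨a, by simpa using this⟩
  have hc2 : 2 ≤ s.card := by
    have := hne.card_pos
    omega
  let p : Fin s.card → E := fun i => (s.equivFin.symm i : E)
  have hp : ∀ i, p i ∈ s := fun i => (s.equivFin.symm i).2
  let L : (Fin s.card → ℝ) →ₗ[ℝ] E := Fintype.linearCombination ℝ p
  have hL : ∀ c, L c = ∑ i, c i • p i := fun c => Fintype.linearCombination_apply _ _ _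
  obtain ⟨x, hx⟩ := KKM.kkm_simplex (I := Fin s.card) (by simpa using hc2)
    (fun i => L ⁻¹' (G (p i)))
    (fun i => hclosed _ (hs (hp i)) _ L.toAffineMap)
    (by
      intro c hc
      let J := Finset.univ.filter (fun i => 0 < c i)
      have hmem : L c ∈ convexHull ℝ ((J.image p : Finset E) : Set E) := by
        have hsum : ∑ i ∈ J, c i • p i = L c := by
          rw [hL]
          refine Finset.sum_subset (Finset.subset_univ _) (fun i _ hi => ?_)
          have : c i = 0 := le_antisymm (by simpa [J] using hi) (hc.1 i)
          rw [this, zero_smul]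
        have hsum1 : ∑ i ∈ J, c i = 1 := by
          rw [← hc.2]
          refine Finset.sum_subset (Finset.subset_univ _) (fun i _ hi => ?_)
          exact le_antisymm (by simpa [J] using hi) (hc.1 i)
        rw [← hsum]
        refine (convex_convexHull ℝ _).sum_mem (fun i _ => hc.1 i) hsum1 (fun i hi => ?_)
        exact subset_convexHull ℝ _ (Finset.mem_coe.2 (Finset.mem_image_of_mem p hi))
      have hJ : ((J.image p : Finset E) : Set E) ⊆ X := by
        intro v hv
        obtain ⟨i, -, rfl⟩ := Finset.mem_image.1 (Finset.mem_coe.1 hv)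
        exact hs (hp i)
      have := hKKM _ hJ hmem
      simp only [Set.mem_iUnion] at this
      obtain ⟨v, hv, hG⟩ := this
      obtain ⟨i, hi, rfl⟩ := Finset.mem_image.1 hv
      exact ⟨i, (Finset.mem_filter.1 hi).2, hG⟩)
  refine ⟨L x, ?_⟩
  simp only [Set.mem_iInter]
  intro v hv
  have := hx (s.equivFin ⟨v, hv⟩)
  simpa [p] using this
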